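/- Let F ∈ ℂ^{s×k} be any matrix, let Z = [I; F] ∈ ℂ^{(k+s)×k} be the block matrix obtained by stacking the k×k identity on top of F, let P_Z = Z(Z^H Z)^{−1} Z^H be the orthogonal projection onto the column space of Z, and let Σ = diag(Σ_1, Σ_2) be block diagonal with Σ_1 ∈ ℂ^{k×k} and Σ_2 ∈ ℂ^{s×s}. Then ‖(I − P_Z)Σ‖_F² ≤ ‖Σ_2‖_F² + ‖F Σ_1‖_F². -/

import Mathlib

open scoped BigOperators
open Matrix

noncomputable section

/-- Squared Frobenius norm: sum of squared norms of the entries. -/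
def frobSq {m n : Type*} [Fintype m] [Fintype n] {α : Type*} [Norm α] (A : Matrix m n α) : ℝ :=
  ∑ i, ∑ j, ‖A i j‖ ^ 2

theorem ofReal_frobSq {m n : Type*} [Fintype m] [Fintype n] (A : Matrix m n ℂ) :
    (frobSq A : ℂ) = (Aᴴ * A).trace := by
  simp only [frobSq, Matrix.trace, Matrix.diag_apply, Matrix.mul_apply,
    Matrix.conjTranspose_apply, Complex.ofReal_sum]
  rw [Finset.sum_comm]
  refine Finset.sum_congr rfl fun j _ => Finset.sum_congr rfl fun i _ => ?_
  rw [Complex.ofReal_pow, ← Complex.conj_mul']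
  rfl

theorem frobSq_nonneg {m n : Type*} [Fintype m] [Fintype n] (A : Matrix m n ℂ) :
    0 ≤ frobSq A :=
  Finset.sum_nonneg fun _ _ => Finset.sum_nonneg fun _ _ => sq_nonneg _

/-- The complement of an orthogonal projection does not increase the Frobenius norm. -/
theorem frobSq_one_sub_mul_le {m n : Type*} [Fintype m] [DecidableEq m] [Fintype n]
    {P : Matrix m m ℂ} (hP : Pᴴ = P) (hPP : P * P = P) (B : Matrix m n ℂ) :
    frobSq ((1 - P) * B) ≤ frobSq B := by
  have hadd : frobSq B = frobSq ((1 - P) * B) + frobSq (P * B) := by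
    apply Complex.ofReal_injective
    rw [Complex.ofReal_add, ofReal_frobSq, ofReal_frobSq, ofReal_frobSq, ← Matrix.trace_add]
    congr 1
    have hPPB : P * (P * B) = P * B := by rw [← Matrix.mul_assoc, hPP]
    simp only [Matrix.conjTranspose_mul, Matrix.conjTranspose_sub, hP,
      Matrix.mul_assoc, Matrix.sub_mul, Matrix.mul_sub, Matrix.one_mul, hPPB]
    abel
  linarith [frobSq_nonneg (P * B)]

open scoped ComplexOrder in
theorem isUnit_det_conjTranspose_mul_fromRows_one {k s : Type*} [Fintype k] [DecidableEq k]
    [Fintype s] (F : Matrix s k ℂ) :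
    IsUnit ((Matrix.fromRows (1 : Matrix k k ℂ) F)ᴴ *
      Matrix.fromRows (1 : Matrix k k ℂ) F : Matrix k k ℂ).det := by
  refine (Matrix.isUnit_iff_isUnit_det _).mp ?_
  rw [Matrix.conjTranspose_fromRows_eq_fromCols_conjTranspose,
    Matrix.fromCols_mul_fromRows, Matrix.conjTranspose_one, Matrix.one_mul]
  exact (Matrix.PosDef.one.add_posSemidef (Matrix.posSemidef_conjTranspose_mul_self F)).isUnit

/-- Let `F ∈ ℂ^{s×k}`, let `Z = [I; F]` be the `k×k` identity stacked on top of `F`, let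
`P_Z = Z (Zᴴ Z)⁻¹ Zᴴ` be the orthogonal projection onto the column space of `Z`, and let
`Σ = diag(Σ₁, Σ₂)` be block diagonal with `Σ₁ ∈ ℂ^{k×k}`, `Σ₂ ∈ ℂ^{s×s}`.  Then
`‖(I - P_Z) Σ‖_F² ≤ ‖Σ₂‖_F² + ‖F Σ₁‖_F²`. -/
theorem projection_deficiency_bound
    {k s : ℕ} (F : Matrix (Fin s) (Fin k) ℂ)
    (S₁ : Matrix (Fin k) (Fin k) ℂ) (S₂ : Matrix (Fin s) (Fin s) ℂ)
    (Z : Matrix (Fin k ⊕ Fin s) (Fin k) ℂ) (hZ : Z = Matrix.fromRows (1 : Matrix (Fin k) (Fin k) ℂ) F)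
    (PZ : Matrix (Fin k ⊕ Fin s) (Fin k ⊕ Fin s) ℂ) (hPZ : PZ = Z * (Zᴴ * Z)⁻¹ * Zᴴ)
    (S : Matrix (Fin k ⊕ Fin s) (Fin k ⊕ Fin s) ℂ)
    (hS : S = Matrix.fromBlocks S₁ 0 0 S₂) :
    frobSq ((1 - PZ) * S) ≤ frobSq S₂ + frobSq (F * S₁) := by
  have hdet : IsUnit (Zᴴ * Z).det := hZ ▸ isUnit_det_conjTranspose_mul_fromRows_one F
  have hPZZ : PZ * Z = Z := by
    rw [hPZ, Matrix.mul_assoc, Matrix.mul_assoc, Matrix.nonsing_inv_mul _ hdet, Matrix.mul_one]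
  have hPP : PZ * PZ = PZ := by
    nth_rewrite 2 [hPZ]
    rw [← Matrix.mul_assoc, ← Matrix.mul_assoc, hPZZ, ← hPZ]
  have hP : PZᴴ = PZ := by
    simp [hPZ, Matrix.conjTranspose_nonsing_inv, Matrix.mul_assoc]
  have hsplit : S = Matrix.fromBlocks 0 0 (-(F * S₁)) S₂ + Z * Matrix.fromCols S₁ 0 := by
    rw [hS, hZ, Matrix.fromRows_mul_fromCols, Matrix.fromBlocks_add]
    simp
  have hmul : (1 - PZ) * S = (1 - PZ) * Matrix.fromBlocks 0 0 (-(F * S₁)) S₂ := by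
    rw [hsplit, Matrix.mul_add, ← Matrix.mul_assoc _ Z, Matrix.sub_mul 1 PZ Z, hPZZ]
    simp
  rw [hmul]
  refine (frobSq_one_sub_mul_le hP hPP _).trans_eq ?_
  simp [frobSq, Fintype.sum_sum_type, Finset.sum_add_distrib, add_comm]

end
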